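/- Let N ∼ 𝒩(0,1) and let h : ℝ → ℝ be twice continuously differentiable with ‖h''‖_∞ ≤ 1. Let f_h be the Stein solution associated with h. Then E[f_h''(N)] = −(1/3) E[h(N) H₃(N)], where H₃(x) = x³ − 3x is the third Hermite polynomial. -/

import Mathlib

open MeasureTheory ProbabilityTheory

/-- The expectation `E[h(N)]` of `h` under the standard Gaussian law. -/
noncomputable def gaussMean (h : ℝ → ℝ) : ℝ := ∫ z, h z ∂(gaussianReal 0 1)

/-- The Stein solution `f_h` associated with `h`. -/
noncomputable def steinSol (h : ℝ → ℝ) (x : ℝ) : ℝ :=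
  Real.exp (x ^ 2 / 2) * ∫ y in Set.Iic x, (h y - gaussMean h) * Real.exp (-y ^ 2 / 2)

open Filter Topology

/-- `F` is dominated by a multiple of the Gaussian `exp (-b x²)`. -/
def GaussianDecay (b : ℝ) (F : ℝ → ℝ) : Prop :=
  ∃ C, ∀ x, |F x| ≤ C * Real.exp (-b * x ^ 2)

/-- `p` grows at most quadratically. -/
def QuadraticGrowth (p : ℝ → ℝ) : Prop :=
  ∃ A, ∀ x, |p x| ≤ A * (1 + x ^ 2)

lemma one_add_sq_le_mul_exp {ε : ℝ} (hε : 0 < ε) (x : ℝ) :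
    1 + x ^ 2 ≤ (1 + ε⁻¹) * Real.exp (ε * x ^ 2) := by
  have h1 : ε * x ^ 2 + 1 ≤ Real.exp (ε * x ^ 2) := Real.add_one_le_exp _
  have h2 : 0 < ε⁻¹ := inv_pos.mpr hε
  calc 1 + x ^ 2 ≤ (1 + ε⁻¹) * (ε * x ^ 2 + 1) := by
        have h3 : ε⁻¹ * (ε * x ^ 2) = x ^ 2 := by field_simp
        have h4 : 0 ≤ ε * x ^ 2 := by positivity
        nlinarith
    _ ≤ _ := by gcongr

lemma GaussianDecay.quadratic_mul {b c : ℝ} {p F : ℝ → ℝ} (hF : GaussianDecay b F)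
    (hp : QuadraticGrowth p) (hcb : c < b) : GaussianDecay c (fun x => p x * F x) := by
  obtain ⟨C, hC⟩ := hF
  obtain ⟨A, hA⟩ := hp
  have hA0 : 0 ≤ A := by simpa using (abs_nonneg _).trans (hA 0)
  have hC0 : 0 ≤ C := by simpa using (abs_nonneg _).trans (hC 0)
  refine ⟨A * (1 + (b - c)⁻¹) * C, fun x => ?_⟩
  calc |p x * F x| = |p x| * |F x| := abs_mul _ _
    _ ≤ (A * ((1 + (b - c)⁻¹) * Real.exp ((b - c) * x ^ 2))) *
          (C * Real.exp (-b * x ^ 2)) := by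
        gcongr
        · exact (hA x).trans (by gcongr; exact one_add_sq_le_mul_exp (sub_pos.mpr hcb) x)
        · exact hC x
    _ = A * (1 + (b - c)⁻¹) * C *
          (Real.exp ((b - c) * x ^ 2) * Real.exp (-b * x ^ 2)) := by ring
    _ = _ := by rw [← Real.exp_add]; ring_nf

lemma GaussianDecay.integrable {b : ℝ} {F : ℝ → ℝ} (hF : GaussianDecay b F) (hb : 0 < b)
    (hcont : Continuous F) : Integrable F := by
  obtain ⟨C, hC⟩ := hF
  exact ((integrable_exp_neg_mul_sq hb).const_mul C).mono' hcont.aestronglyMeasurable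
    (Eventually.of_forall hC)

lemma GaussianDecay.tendsto_cocompact {b : ℝ} {F : ℝ → ℝ} (hF : GaussianDecay b F)
    (hb : 0 < b) : Tendsto F (cocompact ℝ) (𝓝 0) := by
  obtain ⟨C, hC⟩ := hF
  refine squeeze_zero_norm hC ?_
  simpa using (tendsto_rpow_abs_mul_exp_neg_mul_sq_cocompact hb 0).const_mul C

/-- The primitive of a mean-zero function with Gaussian decay has Gaussian decay. -/
lemma GaussianDecay.integral_Iic {b : ℝ} {F : ℝ → ℝ} (hF : GaussianDecay b F) (hb : 0 < b)
    (hcont : Continuous F) (hzero : ∫ y, F y = 0) :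
    GaussianDecay (b / 2) (fun x => ∫ y in Set.Iic x, F y) := by
  have hint := hF.integrable hb hcont
  obtain ⟨C, hC⟩ := hF
  have hC0 : 0 ≤ C := by simpa using (abs_nonneg _).trans (hC 0)
  have hgauss := integrable_exp_neg_mul_sq (half_pos hb)
  refine ⟨C * ∫ y, Real.exp (-(b / 2) * y ^ 2), fun x => ?_⟩
  have tail : ∀ s : Set ℝ, MeasurableSet s → (∀ y ∈ s, x ^ 2 ≤ y ^ 2) →
      |∫ y in s, F y| ≤
        C * (∫ y, Real.exp (-(b / 2) * y ^ 2)) * Real.exp (-(b / 2) * x ^ 2) := by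
    intro s hs hxs
    have hbd : ∀ y ∈ s, ‖F y‖ ≤
        C * Real.exp (-(b / 2) * x ^ 2) * Real.exp (-(b / 2) * y ^ 2) := by
      intro y hy
      refine (hC y).trans ?_
      rw [mul_assoc, ← Real.exp_add]
      gcongr
      nlinarith [hxs y hy]
    calc |∫ y in s, F y|
        ≤ ∫ y in s, C * Real.exp (-(b / 2) * x ^ 2) * Real.exp (-(b / 2) * y ^ 2) :=
          norm_integral_le_of_norm_le (hgauss.const_mul _).integrableOn
            ((ae_restrict_iff' hs).mpr (Eventually.of_forall hbd))
      _ ≤ ∫ y, C * Real.exp (-(b / 2) * x ^ 2) * Real.exp (-(b / 2) * y ^ 2) :=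
          setIntegral_le_integral (hgauss.const_mul _)
            (Eventually.of_forall fun y => by positivity)
      _ = _ := by rw [integral_const_mul]; ring
  rcases le_total x 0 with hx | hx
  · exact tail _ measurableSet_Iic fun y (hy : y ≤ x) => by nlinarith
  · have hcompl := integral_add_compl (measurableSet_Iic (a := x)) hint
    rw [hzero, Set.compl_Iic] at hcompl
    beta_reduce
    rw [eq_neg_of_add_eq_zero_left hcompl, abs_neg]
    exact tail _ measurableSet_Ioi fun y (hy : x < y) => by nlinarith

lemma hasDerivAt_integral_Iic {F : ℝ → ℝ} (hcont : Continuous F) (hint : Integrable F)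
    (x : ℝ) : HasDerivAt (fun u => ∫ y in Set.Iic u, F y) (F x) x := by
  have hderiv := (hcont.integral_hasStrictDerivAt 0 x).hasDerivAt.const_add
    (∫ y in Set.Iic (0 : ℝ), F y)
  refine hderiv.congr_of_eventuallyEq (Eventually.of_forall fun u => ?_)
  simp only [← intervalIntegral.integral_Iic_sub_Iic hint.integrableOn hint.integrableOn]
  ring

lemma integral_stdGaussian (F : ℝ → ℝ) :
    ∫ x, F x ∂(gaussianReal 0 1) =
      (√(2 * Real.pi))⁻¹ * ∫ x, F x * Real.exp (-x ^ 2 / 2) := by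
  rw [integral_gaussianReal_eq_integral_smul one_ne_zero, ← integral_const_mul]
  refine integral_congr_ae (Eventually.of_forall fun x => ?_)
  simp only [gaussianPDFReal, NNReal.coe_one, mul_one, sub_zero, smul_eq_mul]
  ring

lemma gaussianDecay_exp_neg_sq_div_two :
    GaussianDecay (1 / 2) (fun x => Real.exp (-x ^ 2 / 2)) :=
  ⟨1, fun x => by rw [Real.abs_exp, one_mul]; apply le_of_eq; ring_nf⟩

lemma integral_exp_neg_sq_div_two :
    ∫ x : ℝ, Real.exp (-x ^ 2 / 2) = √(2 * Real.pi) := by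
  have h := integral_gaussian (1 / 2)
  rw [show Real.pi / (1 / 2) = 2 * Real.pi by ring] at h
  rw [← h]
  congr 1
  ext x
  ring_nf

lemma hasDerivAt_exp_neg_sq_div_two (x : ℝ) :
    HasDerivAt (fun x : ℝ => Real.exp (-x ^ 2 / 2)) (-x * Real.exp (-x ^ 2 / 2)) x := by
  convert (((hasDerivAt_pow 2 x).fun_neg.div_const 2).exp) using 1
  simp
  ring

lemma hasDerivAt_exp_sq_div_two (x : ℝ) :
    HasDerivAt (fun x : ℝ => Real.exp (x ^ 2 / 2)) (x * Real.exp (x ^ 2 / 2)) x := by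
  convert (((hasDerivAt_pow 2 x).div_const 2).exp) using 1
  simp
  ring

lemma QuadraticGrowth.sub_const {p : ℝ → ℝ} (hp : QuadraticGrowth p) (c : ℝ) :
    QuadraticGrowth (fun x => p x - c) := by
  obtain ⟨A, hA⟩ := hp
  refine ⟨A + |c|, fun x => (abs_sub _ _).trans ?_⟩
  nlinarith [hA x, abs_nonneg c, sq_nonneg x, mul_nonneg (abs_nonneg c) (sq_nonneg x)]

lemma quadraticGrowth_id : QuadraticGrowth (fun x => x) :=
  ⟨1, fun x => by nlinarith [sq_abs x, sq_nonneg (|x| - 1)]⟩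

lemma quadraticGrowth_one_add_mul_sq (a : ℝ) : QuadraticGrowth (fun x => 1 + a * x ^ 2) := by
  refine ⟨1 + |a|, fun x => (abs_add_le _ _).trans ?_⟩
  rw [abs_mul, abs_one, abs_of_nonneg (sq_nonneg x)]
  nlinarith [abs_nonneg a, sq_nonneg x]

lemma abs_sub_zero_le_of_abs_deriv_le {f : ℝ → ℝ} (hf : Differentiable ℝ f) {C x : ℝ}
    (hC : ∀ y, |y| ≤ |x| → |deriv f y| ≤ C) : |f x - f 0| ≤ C * |x| := by
  have h := (convex_closedBall (0 : ℝ) |x|).norm_image_sub_le_of_norm_deriv_le (f := f) (C := C)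
    (x := 0) (y := x) (fun y _ => hf y) (fun y hy => hC y (by simpa using hy))
    (by simp) (by simp)
  simpa using h

lemma abs_deriv_le_of_abs_deriv_deriv_le {h : ℝ → ℝ} (hsmooth : ContDiff ℝ 2 h)
    (hbound : ∀ x, |deriv (deriv h) x| ≤ 1) (x : ℝ) : |deriv h x| ≤ |deriv h 0| + |x| := by
  have hdiff : Differentiable ℝ (deriv h) :=
    (hsmooth.deriv' (n := 1)).differentiable one_ne_zero
  have hsub := abs_sub_zero_le_of_abs_deriv_le hdiff (x := x) fun y _ => hbound y
  have htri := abs_sub_abs_le_abs_sub (deriv h x) (deriv h 0)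
  linarith

lemma quadraticGrowth_deriv {h : ℝ → ℝ} (hsmooth : ContDiff ℝ 2 h)
    (hbound : ∀ x, |deriv (deriv h) x| ≤ 1) : QuadraticGrowth (deriv h) := by
  refine ⟨|deriv h 0| + 1, fun x =>
    (abs_deriv_le_of_abs_deriv_deriv_le hsmooth hbound x).trans ?_⟩
  nlinarith [sq_abs x, sq_nonneg (|x| - 1), mul_nonneg (abs_nonneg (deriv h 0)) (sq_nonneg x)]

lemma quadraticGrowth_of_abs_deriv_deriv_le {h : ℝ → ℝ} (hsmooth : ContDiff ℝ 2 h)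
    (hbound : ∀ x, |deriv (deriv h) x| ≤ 1) : QuadraticGrowth h := by
  refine ⟨|h 0| + |deriv h 0| + 1, fun x => ?_⟩
  have hsub := abs_sub_zero_le_of_abs_deriv_le (hsmooth.differentiable two_ne_zero) (x := x)
    (C := |deriv h 0| + |x|) fun y hy =>
      (abs_deriv_le_of_abs_deriv_deriv_le hsmooth hbound y).trans (by linarith)
  have htri := abs_sub_abs_le_abs_sub (h x) (h 0)
  have hx : |x| ≤ 1 + x ^ 2 := by nlinarith [sq_abs x, sq_nonneg (|x| - 1)]
  nlinarith [sq_abs x, mul_nonneg (abs_nonneg (h 0)) (sq_nonneg x),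
    mul_le_mul_of_nonneg_left hx (abs_nonneg (deriv h 0))]

/-- The Stein equation. -/
lemma hasDerivAt_steinSol {h : ℝ → ℝ} (hcont : Continuous h)
    (hint : Integrable fun y => (h y - gaussMean h) * Real.exp (-y ^ 2 / 2)) (x : ℝ) :
    HasDerivAt (steinSol h) (x * steinSol h x + (h x - gaussMean h)) x := by
  have hprim := hasDerivAt_integral_Iic
    (F := fun y => (h y - gaussMean h) * Real.exp (-y ^ 2 / 2)) (by fun_prop) hint x
  refine HasDerivAt.congr_deriv ((hasDerivAt_exp_sq_div_two x).mul hprim) ?_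
  have hexp : Real.exp (x ^ 2 / 2) * Real.exp (-x ^ 2 / 2) = 1 := by
    rw [← Real.exp_add, ← Real.exp_zero]; ring_nf
  simp only [steinSol]
  linear_combination (h x - gaussMean h) * hexp

lemma deriv_deriv_steinSol {h : ℝ → ℝ} (hdiff : Differentiable ℝ h)
    (hint : Integrable fun y => (h y - gaussMean h) * Real.exp (-y ^ 2 / 2)) (x : ℝ) :
    deriv (deriv (steinSol h)) x =
      (1 + x ^ 2) * steinSol h x + x * (h x - gaussMean h) + deriv h x := by
  have hstein := hasDerivAt_steinSol hdiff.continuous hint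
  rw [funext fun y => (hstein y).deriv]
  refine (((hasDerivAt_id x).mul (hstein x)).add
    ((hdiff x).hasDerivAt.sub_const (gaussMean h))).deriv.trans ?_
  simp only [id]
  ring

lemma integral_sub_gaussMean_mul_exp {h : ℝ → ℝ}
    (hint : Integrable fun y => h y * Real.exp (-y ^ 2 / 2)) :
    ∫ y, (h y - gaussMean h) * Real.exp (-y ^ 2 / 2) = 0 := by
  have hexp := gaussianDecay_exp_neg_sq_div_two.integrable (by norm_num) (by fun_prop)
  simp only [sub_mul]
  rw [integral_sub hint (hexp.const_mul _), integral_const_mul, integral_exp_neg_sq_div_two,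
    gaussMean, integral_stdGaussian]
  have : √(2 * Real.pi) ≠ 0 := by positivity
  field_simp
  ring

lemma integral_cubicHermite_mul_exp :
    ∫ x : ℝ, (x ^ 3 - 3 * x) * Real.exp (-x ^ 2 / 2) = 0 := by
  have h := integral_neg_eq_self (fun x : ℝ => (x ^ 3 - 3 * x) * Real.exp (-x ^ 2 / 2)) volume
  have hodd : (fun x : ℝ => ((-x) ^ 3 - 3 * (-x)) * Real.exp (-(-x) ^ 2 / 2)) =
      fun x : ℝ => -((x ^ 3 - 3 * x) * Real.exp (-x ^ 2 / 2)) := by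
    ext x
    rw [neg_sq]
    ring
  rw [hodd, integral_neg] at h
  linarith

/-- For `h` C² with `‖h''‖_∞ ≤ 1`, `E[f_h''(N)] = -(1/3) E[h(N) H₃(N)]` where
`H₃(x) = x³ - 3x`. -/
theorem stein_second_deriv_mean (h : ℝ → ℝ) (hsmooth : ContDiff ℝ 2 h)
    (hbound : ∀ x, |deriv (deriv h) x| ≤ 1) :
    ∫ x, deriv (deriv (steinSol h)) x ∂(gaussianReal 0 1) =
      -(1 / 3) * ∫ x, h x * (x ^ 3 - 3 * x) ∂(gaussianReal 0 1) := by
  have hdiff : Differentiable ℝ h := hsmooth.differentiable two_ne_zero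
  have hcont : Continuous h := hsmooth.continuous
  have hcont' : Continuous (deriv h) := (hsmooth.deriv' (n := 1)).continuous
  have hgrowth := quadraticGrowth_of_abs_deriv_deriv_le hsmooth hbound
  have hφ := gaussianDecay_exp_neg_sq_div_two
  have hhφ : Integrable fun y => h y * Real.exp (-y ^ 2 / 2) :=
    (hφ.quadratic_mul hgrowth (c := 1 / 4) (by norm_num)).integrable (by norm_num) (by fun_prop)
  set w : ℝ → ℝ := fun y => (h y - gaussMean h) * Real.exp (-y ^ 2 / 2) with hw
  have hwcont : Continuous w := by fun_prop
  have hwdecay : GaussianDecay (1 / 4) w :=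
    hφ.quadratic_mul (hgrowth.sub_const _) (by norm_num)
  have hwint : Integrable w := hwdecay.integrable (by norm_num) hwcont
  set G : ℝ → ℝ := fun x => ∫ y in Set.Iic x, w y
  have hGderiv : ∀ x, HasDerivAt G (w x) x := hasDerivAt_integral_Iic hwcont hwint
  have hGcont : Continuous G :=
    continuous_iff_continuousAt.mpr fun x => (hGderiv x).continuousAt
  have hGdecay : GaussianDecay (1 / 8) G := by
    convert hwdecay.integral_Iic (by norm_num) hwcont (integral_sub_gaussMean_mul_exp hhφ) using 1
    norm_num
  have cubic : ∀ {b c : ℝ} {F : ℝ → ℝ}, GaussianDecay b F → c < b →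
      ∀ a : ℝ, GaussianDecay c (fun x => x * ((1 + a * x ^ 2) * F x)) := by
    intro b c F hF hcb a
    exact (hF.quadratic_mul (quadraticGrowth_one_add_mul_sq a)
      (c := (b + c) / 2) (by linarith)).quadratic_mul quadraticGrowth_id (by linarith)
  have hwderiv : ∀ x, HasDerivAt w (deriv h x * Real.exp (-x ^ 2 / 2) - x * w x) x := by
    intro x
    refine HasDerivAt.congr_deriv (((hdiff x).hasDerivAt.sub_const (gaussMean h)).mul
      (hasDerivAt_exp_neg_sq_div_two x)) ?_
    simp only [hw]
    ring
  -- a primitive of `f_h'' φ + (1/3) (h - E h) H₃ φ`, with `φ` the Gaussian weight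
  set Ψ : ℝ → ℝ := fun x => x * ((1 + (1 / 3) * x ^ 2) * G x) + w x
  set ψ : ℝ → ℝ := fun x =>
    (1 + 1 * x ^ 2) * G x + (x * ((1 + (1 / 3) * x ^ 2) * w x) +
      (deriv h x * Real.exp (-x ^ 2 / 2) + -1 * (x * ((1 + 0 * x ^ 2) * w x)))) with hψ
  have hΨderiv : ∀ x, HasDerivAt Ψ (ψ x) x := by
    intro x
    have hpoly : HasDerivAt (fun x : ℝ => 1 + (1 / 3) * x ^ 2) ((1 / 3) * (2 * x)) x := by
      simpa using ((hasDerivAt_pow 2 x).const_mul (1 / 3 : ℝ)).const_add 1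
    refine HasDerivAt.congr_deriv
      (((hasDerivAt_id x).mul (hpoly.mul (hGderiv x))).add (hwderiv x)) ?_
    simp only [hψ, id, Pi.mul_apply]
    ring
  have hcub_int : ∀ a : ℝ, Integrable fun x => x * ((1 + a * x ^ 2) * w x) := fun a =>
    (cubic hwdecay (c := 1 / 8) (by norm_num) a).integrable (by norm_num) (by fun_prop)
  have hψint : Integrable ψ := by
    refine Integrable.add ?_ ((hcub_int _).add (Integrable.add ?_ ((hcub_int _).const_mul _)))
    · exact (hGdecay.quadratic_mul (quadraticGrowth_one_add_mul_sq 1)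
        (c := 1 / 16) (by norm_num)).integrable (by norm_num) (by fun_prop)
    · exact (hφ.quadratic_mul (quadraticGrowth_deriv hsmooth hbound)
        (c := 1 / 4) (by norm_num)).integrable (by norm_num) (by fun_prop)
  have hΨlim : Tendsto Ψ (cocompact ℝ) (𝓝 0) := by
    rw [← add_zero (0 : ℝ)]
    exact ((cubic hGdecay (c := 1 / 16) (by norm_num) (1 / 3)).tendsto_cocompact
      (by norm_num)).add (hwdecay.tendsto_cocompact (by norm_num))
  have hψzero : ∫ x, ψ x = 0 := by
    rw [integral_of_hasDerivAt_of_tendsto hΨderiv hψint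
      (hΨlim.mono_left atBot_le_cocompact) (hΨlim.mono_left atTop_le_cocompact), sub_zero]
  have hH3 : (fun x => (x ^ 3 - 3 * x) * w x) = fun x =>
      3 * (x * ((1 + (1 / 3) * x ^ 2) * w x)) - 6 * (x * ((1 + 0 * x ^ 2) * w x)) := by
    ext x
    ring
  have hH3int : Integrable fun x => (x ^ 3 - 3 * x) * w x := by
    rw [hH3]
    exact ((hcub_int _).const_mul _).sub ((hcub_int _).const_mul _)
  have hleft : (fun x => deriv (deriv (steinSol h)) x * Real.exp (-x ^ 2 / 2)) =
      fun x => ψ x - (1 / 3) * ((x ^ 3 - 3 * x) * w x) := by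
    ext x
    have hexp : Real.exp (x ^ 2 / 2) * Real.exp (-x ^ 2 / 2) = 1 := by
      rw [← Real.exp_add, ← Real.exp_zero]; ring_nf
    have hsol : steinSol h x * Real.exp (-x ^ 2 / 2) = G x := by
      change Real.exp (x ^ 2 / 2) * G x * Real.exp (-x ^ 2 / 2) = G x
      linear_combination G x * hexp
    rw [deriv_deriv_steinSol hdiff hwint]
    simp only [hψ]
    linear_combination (1 + x ^ 2) * hsol
  have hright : ∫ x, h x * (x ^ 3 - 3 * x) * Real.exp (-x ^ 2 / 2) =
      ∫ x, (x ^ 3 - 3 * x) * w x := by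
    have hsplit : (fun x => h x * (x ^ 3 - 3 * x) * Real.exp (-x ^ 2 / 2)) = fun x =>
        (x ^ 3 - 3 * x) * w x +
          gaussMean h * ((x ^ 3 - 3 * x) * Real.exp (-x ^ 2 / 2)) := by
      ext x
      simp only [hw]
      ring
    have hodd : Integrable fun x : ℝ => (x ^ 3 - 3 * x) * Real.exp (-x ^ 2 / 2) := by
      have := ((cubic hφ (c := 1 / 4) (by norm_num) (-1 / 3)).integrable (by norm_num)
        (by fun_prop)).const_mul (-3)
      exact this.congr (Eventually.of_forall fun x => by ring)
    rw [hsplit, integral_add hH3int (hodd.const_mul _), integral_const_mul,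
      integral_cubicHermite_mul_exp, mul_zero, add_zero]
  rw [integral_stdGaussian, integral_stdGaussian, hleft, hright,
    integral_sub hψint (hH3int.const_mul _), integral_const_mul, hψzero]
  ring
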